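/- Let k be a field of characteristic 5 and τ ∈ k[[x,y]] an element of the form τ = 2(y² + x³) + h with h in the ideal (x⁴, x²y, xy², y³). Then the subring B = k[[x⁵, y⁵, τ]] of k[[x,y]] is isomorphic to k[[X,Y,Z]]/(X² + Y³ + Z⁵), a rational double point of type E₈. -/

import Mathlib

open MvPowerSeries

/-- A ring endomorphism that is congruent to the identity on the associated graded ring of a
complete ideal is bijective. -/
theorem RingHom.bijective_of_sub_mem_pow_succ {R : Type*} [CommRing R] (I : Ideal R)
    [IsAdicComplete I R] (φ : R →+* R) (hφ : ∀ n, ∀ f ∈ I ^ n, φ f - f ∈ I ^ (n + 1)) :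
    Function.Bijective φ := by
  constructor
  · rw [injective_iff_map_eq_zero]
    intro f hf
    have hmem : ∀ n, f ∈ I ^ n := by
      intro n
      induction n with
      | zero => simp
      | succ n ih => simpa [hf] using hφ n f ih
    refine IsHausdorff.haus (I := I) inferInstance f fun n ↦ ?_
    simpa [SModEq.zero] using hmem n
  · intro f
    let N : R → R := fun g ↦ g - φ g
    have hN : ∀ n, N^[n] f ∈ I ^ n := by
      intro n
      induction n with
      | zero => simp
      | succ n ih =>
        rw [Function.iterate_succ_apply']
        simpa [N] using neg_mem (hφ n _ ih)
    let S : ℕ → R := fun n ↦ ∑ i ∈ Finset.range n, N^[i] f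
    have hS : ∀ n, φ (S n) = f - N^[n] f := by
      intro n
      induction n with
      | zero => simp [S]
      | succ n ih =>
        have : φ (S (n + 1)) = φ (S n) + φ (N^[n] f) := by
          simp [S, Finset.sum_range_succ]
        rw [this, ih, Function.iterate_succ_apply']
        simp only [N]
        ring
    have hcauchy : ∀ {m n}, m ≤ n → S m ≡ S n [SMOD (I ^ m • ⊤ : Submodule R R)] := by
      intro m n hmn
      induction n, hmn using Nat.le_induction with
      | base => rfl
      | succ n hmn ih =>
        refine ih.trans (SModEq.symm ?_)
        rw [SModEq.sub_mem, smul_eq_mul, Ideal.mul_top]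
        simpa [S, Finset.sum_range_succ] using Ideal.pow_le_pow_right hmn (hN n)
    obtain ⟨g, hg⟩ := IsPrecomplete.prec' (I := I) S hcauchy
    refine ⟨g, ?_⟩
    rw [← sub_eq_zero]
    refine IsHausdorff.haus (I := I) inferInstance _ fun n ↦ ?_
    have hgn : g - S n ∈ I ^ n := by
      simpa [SModEq.sub_mem] using (hg n).symm
    have h1 : φ (g - S n) ∈ I ^ n := by
      have := add_mem (Ideal.pow_le_pow_right n.le_succ (hφ n _ hgn)) hgn
      simpa using this
    have h2 : φ g - f = φ (g - S n) - N^[n] f := by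
      rw [map_sub, hS]
      ring
    rw [SModEq.zero, smul_eq_mul, Ideal.mul_top, h2]
    exact sub_mem h1 (hN n)

/-- Powers of an element with non-vanishing derivative are linearly independent over the
constants of a derivation, up to the characteristic. -/
theorem Derivation.eq_zero_of_sum_mul_pow_eq_zero {k R : Type*} [CommRing k] [CommRing R]
    [IsDomain R] [Algebra k R] (D : Derivation k R R) {x : R} (hx : D x ≠ 0) (n : ℕ)
    (hn : ∀ j < n, j ≠ 0 → (j : R) ≠ 0) (c : ℕ → R) (hc : ∀ j, D (c j) = 0)
    (hsum : ∑ j ∈ Finset.range n, c j * x ^ j = 0) : ∀ j < n, c j = 0 := by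
  induction n generalizing c with
  | zero => simp
  | succ n ih =>
    have hD : ∑ j ∈ Finset.range n, ((j + 1 : ℕ) * c (j + 1)) * x ^ j = 0 := by
      have h := congrArg D hsum
      rw [map_sum, map_zero, Finset.sum_range_succ'] at h
      simp only [Derivation.leibniz, Derivation.leibniz_pow, hc, pow_zero,
        Derivation.map_one_eq_zero, smul_eq_mul, nsmul_eq_mul, Nat.add_sub_cancel, mul_zero,
        add_zero] at h
      refine (mul_eq_zero.mp ?_).resolve_left hx
      rw [Finset.mul_sum, ← h]
      exact Finset.sum_congr rfl fun j _ ↦ by ring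
    have hsucc : ∀ j < n, c (j + 1) = 0 := fun j hj ↦
      (mul_eq_zero.mp (ih (fun j hj ↦ hn j (by lia)) _ (fun j ↦ by simp [hc]) hD j hj)).resolve_left
        (hn _ (by lia) (by lia))
    have hzero : c 0 = 0 := by
      rw [Finset.sum_range_succ', Finset.sum_eq_zero fun j hj ↦ by
        rw [hsucc j (Finset.mem_range.mp hj), zero_mul]] at hsum
      simpa using hsum
    rintro (_ | j) hj
    · exact hzero
    · exact hsucc j (by lia)

namespace MvPowerSeries

theorem finSuccEquiv_rename_succ {R : Type*} [CommRing R] {n : ℕ} (a : MvPowerSeries (Fin n) R) :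
    finSuccEquiv R n (rename Fin.succ a) = PowerSeries.C a := by
  ext i x
  rw [coeff_coeff_finSuccEquiv, PowerSeries.coeff_C]
  split_ifs with hi
  · subst hi
    have : Finsupp.cons 0 x = Finsupp.embDomain (Fin.succEmb n) x := by
      ext j
      refine Fin.cases ?_ (fun j ↦ ?_) j
      · rw [Finsupp.cons_zero, Finsupp.embDomain_of_notMem_range]
        simp
      · rw [Finsupp.cons_succ]
        exact (Finsupp.embDomain_apply_self (Fin.succEmb n) x j).symm
    rw [this]
    exact coeff_embDomain_rename (Fin.succEmb n) a x
  · rw [map_zero]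
    refine coeff_rename_eq_zero _ a ?_
    rintro ⟨y, hy⟩
    apply hi
    have := DFunLike.congr_fun hy 0
    rw [Finsupp.cons_zero, Finsupp.mapDomain_of_notMem_range] at this
    · exact this.symm
    · simp

theorem mem_span_range_X_of_constantCoeff_eq_zero {R : Type*} [CommRing R] {n : ℕ}
    {f : MvPowerSeries (Fin n) R} (hf : constantCoeff f = 0) :
    f ∈ Ideal.span (Set.range (X : Fin n → MvPowerSeries (Fin n) R)) := by
  induction n with
  | zero =>
    have : f = 0 := by
      ext d
      rw [Subsingleton.elim d 0]
      simpa using hf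
    simp [this]
  | succ n ih =>
    obtain ⟨g, hg⟩ := PowerSeries.X_dvd_iff.mpr (show PowerSeries.constantCoeff
      (finSuccEquiv R n f - PowerSeries.C (PowerSeries.constantCoeff (finSuccEquiv R n f))) = 0 by
        simp)
    set a := PowerSeries.constantCoeff (finSuccEquiv R n f) with ha
    have ha0 : constantCoeff a = 0 := by
      rw [ha, ← PowerSeries.coeff_zero_eq_constantCoeff_apply, ← coeff_zero_eq_constantCoeff_apply,
        coeff_coeff_finSuccEquiv, Finsupp.cons_zero_zero]
      simpa using hf
    have hfa : f = rename Fin.succ a + X 0 * (finSuccEquiv R n).symm g := by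
      apply (finSuccEquiv R n).injective
      rw [map_add, map_mul, finSuccEquiv_rename_succ, finSuccEquiv_X_zero,
        AlgEquiv.apply_symm_apply, ← hg]
      ring
    rw [hfa]
    refine add_mem ?_ (Ideal.mul_mem_right _ _ (Ideal.subset_span ⟨0, rfl⟩))
    have h1 := Ideal.mem_map_of_mem
      (rename (R := R) (Fin.succ : Fin n → Fin (n + 1))).toRingHom (ih ha0)
    rw [Ideal.map_span] at h1
    refine Ideal.span_mono ?_ h1
    rintro _ ⟨_, ⟨i, rfl⟩, rfl⟩
    exact ⟨i.succ, by simp⟩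

theorem constantCoeff_eq_zero_of_mem_span_range_X {R σ : Type*} [CommRing R]
    {f : MvPowerSeries σ R}
    (hf : f ∈ Ideal.span (Set.range (X : σ → MvPowerSeries σ R))) : constantCoeff f = 0 := by
  have : Ideal.span (Set.range (X : σ → MvPowerSeries σ R)) ≤ RingHom.ker constantCoeff := by
    rw [Ideal.span_le]
    rintro _ ⟨i, rfl⟩
    simp
  exact this hf

/-- An endomorphism of a power series ring whose linear part is the identity is bijective. -/
theorem bijective_of_map_X_sub_X_mem {R : Type*} [CommRing R] {n : ℕ}
    (φ : MvPowerSeries (Fin n) R →ₐ[R] MvPowerSeries (Fin n) R)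
    (hφ : ∀ i, φ (X i) - X i ∈ Ideal.span (Set.range (X : Fin n → MvPowerSeries (Fin n) R)) ^ 2) :
    Function.Bijective φ := by
  set I := Ideal.span (Set.range (X : Fin n → MvPowerSeries (Fin n) R)) with hI
  have hX : ∀ i, φ (X i) ∈ I := fun i ↦ by
    have := add_mem (Ideal.pow_le_self two_ne_zero (hφ i)) (Ideal.subset_span ⟨i, rfl⟩)
    simpa using this
  have hmap : I ≤ I.comap φ := by
    rw [hI, Ideal.span_le]
    rintro _ ⟨i, rfl⟩
    exact hX i
  have h0 : ∀ f, φ f - f ∈ I := by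
    intro f
    have hf : f - C (constantCoeff f) ∈ I :=
      mem_span_range_X_of_constantCoeff_eq_zero (by simp)
    have h := sub_mem (show φ _ ∈ I from hmap hf) hf
    have hC : φ (C (constantCoeff f)) = C (constantCoeff f) := φ.commutes _
    convert h using 1
    rw [map_sub, hC]
    ring
  have h1 : ∀ f ∈ I, φ f - f ∈ I ^ 2 := by
    intro f hf
    induction hf using Submodule.span_induction with
    | mem x hx =>
      obtain ⟨i, rfl⟩ := hx
      exact hφ i
    | zero => simp
    | add x y _ _ hx hy =>
      convert add_mem hx hy using 1
      rw [map_add]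
      ring
    | smul a x hx ih =>
      have : φ (a • x) - a • x = φ a * (φ x - x) + (φ a - a) * x := by
        rw [smul_eq_mul, map_mul]
        ring
      rw [this]
      refine add_mem (Ideal.mul_mem_left _ _ ih) ?_
      rw [pow_two]
      exact Ideal.mul_mem_mul (h0 a) hx
  refine RingHom.bijective_of_sub_mem_pow_succ I (φ : _ →+* _) fun m ↦ ?_
  induction m with
  | zero => simpa using h0
  | succ m ih =>
    intro f hf
    rw [pow_succ] at hf
    induction hf using Submodule.mul_induction_on' with
    | mem_mul_mem a ha b hb =>
      have key : φ (a * b) - a * b = φ a * (φ b - b) + (φ a - a) * b := by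
        rw [map_mul]
        ring
      have hφa : φ a ∈ I ^ m := by
        simpa using add_mem (Ideal.pow_le_pow_right m.le_succ (ih a ha)) ha
      change φ (a * b) - a * b ∈ _
      rw [key]
      refine add_mem ?_ ?_
      · rw [add_assoc, pow_add]
        exact Ideal.mul_mem_mul hφa (h1 b hb)
      · rw [pow_succ _ (m + 1)]
        exact Ideal.mul_mem_mul (ih a ha) hb
    | add x _ y _ hx hy =>
      convert add_mem hx hy using 1
      rw [map_add]
      ring

theorem exists_pow_eq_of_constantCoeff_eq_one {R : Type*} [CommRing R] {m n : ℕ} (hn0 : n ≠ 0)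
    (hn : IsUnit (n : R)) {f : MvPowerSeries (Fin m) R}
    (hf : constantCoeff f = 1) : ∃ g, g ^ n = f ∧ constantCoeff g = 1 := by
  obtain ⟨g, hg, hg1⟩ := HenselianRing.is_henselian
    (I := Ideal.span (Set.range (X : Fin m → MvPowerSeries (Fin m) R)))
    (Polynomial.X ^ n - Polynomial.C f) (Polynomial.monic_X_pow_sub_C f hn0) 1
    (mem_span_range_X_of_constantCoeff_eq_zero (by simp [hf]))
    (by
      have := hn.map ((Ideal.Quotient.mk (Ideal.span (Set.range
        (X : Fin m → MvPowerSeries (Fin m) R)))).comp C)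
      simpa [Polynomial.derivative_X_pow] using this)
  refine ⟨g, ?_, ?_⟩
  · simpa [sub_eq_zero] using hg
  · simpa [sub_eq_zero] using constantCoeff_eq_zero_of_mem_span_range_X hg1

theorem pderiv_expand_eq_zero {R σ : Type*} [CommRing R] (p : ℕ) [CharP R p] (hp : p ≠ 0) (i : σ)
    (f : MvPowerSeries σ R) : pderiv R i (expand p hp f) = 0 := by
  ext d
  rw [coeff_pderiv, map_zero]
  by_cases h : p ∣ d i + 1
  · have : ((d i + 1 : ℕ) : R) = 0 := (CharP.cast_eq_zero_iff R p _).mpr h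
    push_cast at this
    rw [this, mul_zero]
  · rw [coeff_expand_of_not_dvd p hp f (i := i) (by simpa using h), zero_mul]

theorem expand_injective {R σ : Type*} [CommRing R] (p : ℕ) (hp : p ≠ 0) :
    Function.Injective (expand p hp : MvPowerSeries σ R →ₐ[R] MvPowerSeries σ R) := by
  intro f g hfg
  ext d
  rw [← coeff_expand_smul p hp f, hfg, coeff_expand_smul]

/-- Weierstrass division by `X ^ n - w` in the last variable. -/
theorem exists_eq_X_pow_sub_rename_mul_add_sum {k : Type*} [Field k] {m : ℕ}
    {w : MvPowerSeries (Fin m) k}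
    (hw : constantCoeff w = 0) {n : ℕ} (hn : n ≠ 0) (p : MvPowerSeries (Fin (m + 1)) k) :
    ∃ (q : MvPowerSeries (Fin (m + 1)) k) (c : ℕ → MvPowerSeries (Fin m) k),
      p = (X (Fin.last m) ^ n - rename Fin.castSucc w) * q +
        ∑ j ∈ Finset.range n, rename Fin.castSucc (c j) * X (Fin.last m) ^ j := by
  set I := Ideal.span (Set.range (X : Fin m → MvPowerSeries (Fin m) k))
  let E := (renameEquiv k (finRotate (m + 1))).trans (finSuccEquiv k m)
  have hE (a : MvPowerSeries (Fin m) k) : E (rename Fin.castSucc a) = PowerSeries.C a := by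
    have : ⇑(finRotate (m + 1)) ∘ Fin.castSucc = Fin.succ := by
      ext i
      simp
    change finSuccEquiv k m (rename (finRotate (m + 1)) (rename Fin.castSucc a)) = _
    rw [rename_rename]
    simp_rw [this]
    exact finSuccEquiv_rename_succ a
  have hEX : E (X (Fin.last m)) = PowerSeries.X := by
    simp [E]
  have hI : I ≠ ⊤ := by
    rw [Ideal.ne_top_iff_one]
    intro h
    simpa using constantCoeff_eq_zero_of_mem_span_range_X h
  let g : Polynomial (MvPowerSeries (Fin m) k) := Polynomial.X ^ n - Polynomial.C w
  have hdeg : g.natDegree = n := Polynomial.natDegree_X_pow_sub_C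
  have hg : g.IsDistinguishedAt I := by
    refine ⟨⟨fun {i} hi ↦ ?_⟩, Polynomial.monic_X_pow_sub_C w hn⟩
    rw [hdeg] at hi
    simp only [g, Polynomial.coeff_sub, Polynomial.coeff_X_pow, hi.ne, if_false, zero_sub,
      Polynomial.coeff_C]
    split_ifs
    · exact neg_mem (mem_span_range_X_of_constantCoeff_eq_zero hw)
    · simp
  have horder := congrArg ENat.toNat (hg.coe_natDegree_eq_order_map (g : PowerSeries _) 1
    (by rwa [PowerSeries.constantCoeff_one, ← Ideal.ne_top_iff_one]) (by simp))
  rw [ENat.toNat_natCast, hdeg] at horder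
  have hdiv := (hg.isWeierstrassDivisorAt hI).isWeierstrassDivisionAt_div_mod (E p)
  set q := (hg.isWeierstrassDivisorAt hI).div (E p)
  set r := (hg.isWeierstrassDivisorAt hI).mod (E p)
  have hr : r.degree < n := by
    have := hdiv.degree_lt
    rwa [← horder] at this
  replace hr : r.natDegree < n := by
    rcases eq_or_ne r 0 with h | h
    · simpa [h] using Nat.pos_of_ne_zero hn
    · exact (Polynomial.natDegree_lt_iff_degree_lt h).mpr hr
  refine ⟨E.symm q, r.coeff, E.injective ?_⟩
  rw [hdiv.eq_mul_add, map_add, map_mul, map_sub, map_pow, hE, hEX, AlgEquiv.apply_symm_apply,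
    map_sum]
  congr 1
  · simp [g]
  · conv_lhs => rw [r.as_sum_range' n hr]
    simp only [map_mul, map_pow, hE, hEX, ← Polynomial.C_mul_X_pow_eq_monomial]
    rw [← Polynomial.coeToPowerSeries.ringHom_apply, map_sum]
    simp

theorem hasSubst_of_fin_three {R : Type*} [CommRing R] {τ : Type*} {a b c : MvPowerSeries τ R}
    (ha : constantCoeff a = 0) (hb : constantCoeff b = 0) (hc : constantCoeff c = 0) :
    HasSubst ![a, b, c] := by
  refine hasSubst_of_constantCoeff_zero fun i ↦ ?_
  fin_cases i <;> simpa

/-- The substitution of `x ^ p`, `y ^ p`, `τ` restricts to `expand p` on series in the first two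
variables. -/
theorem subst_rename_castSucc {R : Type*} [CommRing R] {p : ℕ} (hp : p ≠ 0)
    {τ : MvPowerSeries (Fin 2) R} (hτ : HasSubst ![X 0 ^ p, X 1 ^ p, τ])
    (f : MvPowerSeries (Fin 2) R) :
    substAlgHom hτ (rename Fin.castSucc f : MvPowerSeries (Fin 3) R) = expand p hp f := by
  rw [coe_substAlgHom, rename_eq_subst, subst_comp_subst_apply (HasSubst.X_comp _) hτ, expand,
    coe_substAlgHom]
  congr 1
  ext1 i
  fin_cases i
  · exact subst_X hτ 0
  · exact subst_X hτ 1

/-- The kernel of the substitution of `x ^ p`, `y ^ p`, `τ` is generated by `t ^ p - w` if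
`τ ^ p = w (x ^ p, y ^ p)` and `τ` is separable. -/
theorem ker_subst_eq_span {k : Type*} [Field k] {p : ℕ} [CharP k p] (hp : p ≠ 0)
    {τ w : MvPowerSeries (Fin 2) k} (hτ : HasSubst ![X 0 ^ p, X 1 ^ p, τ])
    (hw : constantCoeff w = 0) (hτw : τ ^ p = expand p hp w) {i : Fin 2}
    (hi : pderiv k i τ ≠ 0) :
    RingHom.ker (substAlgHom (R := k) hτ) =
      Ideal.span {(X 2 ^ p - rename Fin.castSucc w : MvPowerSeries (Fin 3) k)} := by
  have hX2 : substAlgHom (R := k) hτ (X 2) = τ := substAlgHom_X hτ 2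
  have hF : substAlgHom (R := k) hτ (X 2 ^ p - rename Fin.castSucc w) = 0 := by
    rw [map_sub, map_pow, hX2, subst_rename_castSucc hp, hτw, sub_self]
  apply le_antisymm
  · intro f hf
    obtain ⟨q, c, hfq⟩ := exists_eq_X_pow_sub_rename_mul_add_sum hw hp f
    have hsum : ∑ j ∈ Finset.range p, expand p hp (c j) * τ ^ j = 0 := by
      have hf0 : substAlgHom (R := k) hτ f = 0 := hf
      rw [hfq, map_add, map_mul, show Fin.last 2 = 2 from rfl, hF, zero_mul, zero_add,
        map_sum] at hf0
      rw [← hf0]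
      refine Finset.sum_congr rfl fun j _ ↦ ?_
      rw [map_mul, map_pow, hX2, subst_rename_castSucc hp]
    have : IsDomain (MvPowerSeries (Fin 2) k) := NoZeroDivisors.to_isDomain _
    have hc := (pderiv k i).eq_zero_of_sum_mul_pow_eq_zero hi p (fun j hj hj0 h ↦ by
      have := congrArg constantCoeff h
      rw [map_natCast, map_zero, CharP.cast_eq_zero_iff k p] at this
      exact absurd (Nat.le_of_dvd (Nat.pos_of_ne_zero hj0) this) (by lia)) _
      (fun j ↦ pderiv_expand_eq_zero p hp i (c j)) hsum
    have hc0 : ∀ j < p, c j = 0 := fun j hj ↦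
      expand_injective p hp (by rw [hc j hj, map_zero])
    rw [Finset.sum_eq_zero fun j hj ↦ by rw [hc0 j (Finset.mem_range.mp hj), map_zero, zero_mul],
      add_zero] at hfq
    rw [hfq]
    exact Ideal.mul_mem_right _ _ (Ideal.subset_span rfl)
  · rw [Ideal.span_singleton_le_iff_mem]
    exact hF

theorem bijective_substAlgHom_swap {R : Type*} [CommRing R] {a : R} (ha : IsUnit a)
    (hs : HasSubst ![(X 1 : MvPowerSeries (Fin 3) R), X 0, C a * X 2]) :
    Function.Bijective (substAlgHom (R := R) hs) := by
  have hcomp {a b : R} (hab : a * b = 1)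
      (ha : HasSubst ![(X 1 : MvPowerSeries (Fin 3) R), X 0, C a * X 2])
      (hb : HasSubst ![(X 1 : MvPowerSeries (Fin 3) R), X 0, C b * X 2])
      (f : MvPowerSeries (Fin 3) R) :
      substAlgHom (R := R) hb (substAlgHom (R := R) ha f) = f := by
    rw [coe_substAlgHom, coe_substAlgHom, subst_comp_subst_apply ha hb]
    refine Eq.trans ?_ (congrFun (subst_self (σ := Fin 3) (R := R)) f)
    congr 1
    ext1 i
    rw [← coe_substAlgHom hb]
    fin_cases i
    · exact substAlgHom_X hb 1
    · exact substAlgHom_X hb 0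
    · have hC : substAlgHom hb (C a) = C a := (substAlgHom (R := R) hb).commutes a
      have hX2 : substAlgHom (R := R) hb (X 2) = C b * X 2 := substAlgHom_X hb 2
      change substAlgHom hb (C a * X 2) = X 2
      rw [map_mul, hC, hX2, ← mul_assoc, ← map_mul, hab, map_one, one_mul]
  obtain ⟨b, hab⟩ := ha.exists_right_inv
  have hs' : HasSubst ![(X 1 : MvPowerSeries (Fin 3) R), X 0, C b * X 2] :=
    hasSubst_of_fin_three (by simp) (by simp) (by simp)
  exact Function.bijective_iff_has_inverse.mpr
    ⟨substAlgHom hs', hcomp hab hs hs', hcomp (by rwa [mul_comm]) hs' hs⟩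

/-- In characteristic `5`, completing the square and extracting roots of units brings the equation
`t ^ 5 - 2 (u ^ 3 + v ^ 2) - h = 0` to `X ^ 2 + Y ^ 3 + Z ^ 5 = 0`. -/
theorem exists_bijective_algHom_map_eq {k : Type*} [Field k] [CharP k 5]
    {h : MvPowerSeries (Fin 3) k}
    (hh : h ∈ Ideal.span {(X 0 : MvPowerSeries (Fin 3) k) ^ 4,
      (X 0) ^ 2 * X 1, X 0 * (X 1) ^ 2, (X 1) ^ 3}) :
    ∃ φ : MvPowerSeries (Fin 3) k →ₐ[k] MvPowerSeries (Fin 3) k, Function.Bijective φ ∧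
      φ (X 0 ^ 2 + X 1 ^ 3 + X 2 ^ 5) = 2 * (X 2 ^ 5 - (2 * (X 1 ^ 2 + X 0 ^ 3) + h)) := by
  have h5 : (5 : MvPowerSeries (Fin 3) k) = 0 := by
    have := congrArg (C (σ := Fin 3)) (CharP.cast_eq_zero k 5)
    rwa [map_natCast, map_zero, Nat.cast_ofNat] at this
  have hunit (n : ℕ) (hn : ¬ 5 ∣ n) : IsUnit (n : k) := by
    rwa [isUnit_iff_ne_zero, Ne, CharP.cast_eq_zero_iff k 5]
  simp only [Ideal.mem_span_insert, Ideal.mem_span_singleton'] at hh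
  obtain ⟨A, _, ⟨B, _, ⟨Γ, _, ⟨Δ, rfl⟩, rfl⟩, rfl⟩, rfl⟩ := hh
  obtain ⟨e, he, he1⟩ := exists_pow_eq_of_constantCoeff_eq_one two_ne_zero
    (hunit 2 (by norm_num)) (f := 1 + (-2 * Γ * X 0 - 2 * Δ * X 1 : MvPowerSeries (Fin 3) k))
    (by simp)
  have hee : e * e⁻¹ = 1 := MvPowerSeries.mul_inv_cancel e (by simp [he1])
  set e' := e⁻¹
  obtain ⟨r, hr, hr1⟩ := exists_pow_eq_of_constantCoeff_eq_one three_ne_zero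
    (hunit 3 (by norm_num)) (f := 1 + X 0 * (-2 * A + 4 * B ^ 2 * e' ^ 2)) (by simp)
  set P : MvPowerSeries (Fin 3) k := e * X 1 - B * X 0 ^ 2 * e' with hP
  set Q : MvPowerSeries (Fin 3) k := X 0 * r with hQ
  have hψ : HasSubst ![Q, P, X 2] := hasSubst_of_fin_three (by simp [hQ]) (by simp [hP]) (by simp)
  have hlam : HasSubst ![(X 1 : MvPowerSeries (Fin 3) k), X 0, C 2 * X 2] :=
    hasSubst_of_fin_three (by simp) (by simp) (by simp)
  have hψbij : Function.Bijective (substAlgHom (R := k) hψ) := by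
    refine bijective_of_map_X_sub_X_mem _ fun i ↦ ?_
    have hX (j : Fin 3) := Ideal.subset_span
      (show (X j : MvPowerSeries (Fin 3) k) ∈ Set.range X from ⟨j, rfl⟩)
    rw [substAlgHom_X, pow_two]
    fin_cases i
    · change Q - X 0 ∈ _
      rw [show Q - X 0 = X 0 * (r - 1) by rw [hQ]; ring]
      exact Ideal.mul_mem_mul (hX 0) (mem_span_range_X_of_constantCoeff_eq_zero (by simp [hr1]))
    · change P - X 1 ∈ _
      rw [show P - X 1 = (e - 1) * X 1 - B * e' * (X 0 * X 0) by rw [hP]; ring]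
      exact sub_mem (Ideal.mul_mem_mul
        (mem_span_range_X_of_constantCoeff_eq_zero (by simp [he1])) (hX 1))
        (Ideal.mul_mem_left _ _ (Ideal.mul_mem_mul (hX 0) (hX 0)))
    · simp
  refine ⟨(substAlgHom hψ).comp (substAlgHom hlam), hψbij.comp
    (bijective_substAlgHom_swap (by simpa using hunit 2 (by norm_num)) hlam), ?_⟩
  have hl0 : substAlgHom (R := k) hlam (X 0) = X 1 := substAlgHom_X hlam 0
  have hl1 : substAlgHom (R := k) hlam (X 1) = X 0 := substAlgHom_X hlam 1
  have hl2 : substAlgHom (R := k) hlam (X 2) = 2 * X 2 := by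
    rw [substAlgHom_X]
    change C 2 * X 2 = _
    rw [map_ofNat]
  have hψ0 : substAlgHom (R := k) hψ (X 0) = Q := substAlgHom_X hψ 0
  have hψ1 : substAlgHom (R := k) hψ (X 1) = P := substAlgHom_X hψ 1
  have hψ2 : substAlgHom (R := k) hψ (X 2) = X 2 := substAlgHom_X hψ 2
  have h2 (φ : MvPowerSeries (Fin 3) k →ₐ[k] MvPowerSeries (Fin 3) k) : φ 2 = 2 := map_ofNat φ 2
  simp only [AlgHom.comp_apply, map_add, map_pow, map_mul, hl0, hl1, hl2, hψ0, hψ1, hψ2, h2]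
  rw [hP, hQ]
  linear_combination X 1 ^ 2 * he - 2 * B * X 0 ^ 2 * X 1 * hee + X 0 ^ 3 * hr +
    (6 * X 2 ^ 5 + X 1 ^ 2 + X 0 ^ 3 + B ^ 2 * e' ^ 2 * X 0 ^ 4) * h5

end MvPowerSeries

/-- Let `k` have characteristic 5 and `τ = 2(y² + x³) + h ∈ k[[x,y]]` with
`h ∈ (x⁴, x²y, xy², y³)`. Then the subring `B = k[[x⁵, y⁵, τ]]` — the image of a
`k`-algebra homomorphism from `k[[u,v,t]]` sending `u, v, t` to `x⁵, y⁵, τ` — is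
isomorphic to `k[[X,Y,Z]]/(X² + Y³ + Z⁵)`, a rational double point of type `E₈`. -/
theorem E8_subring_of_power_series
    (k : Type*) [Field k] [CharP k 5]
    (h τ : MvPowerSeries (Fin 2) k)
    (hh : h ∈ Ideal.span {(X 0 : MvPowerSeries (Fin 2) k) ^ 4,
      (X 0) ^ 2 * X 1, X 0 * (X 1) ^ 2, (X 1) ^ 3})
    (hτ : τ = 2 * ((X 1) ^ 2 + (X 0) ^ 3) + h) :
    ∃ θ : MvPowerSeries (Fin 3) k →ₐ[k] MvPowerSeries (Fin 2) k,
      θ (X 0) = (X 0) ^ 5 ∧ θ (X 1) = (X 1) ^ 5 ∧ θ (X 2) = τ ∧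
      Nonempty (θ.range ≃+* (MvPowerSeries (Fin 3) k ⧸
        Ideal.span {(X 0 : MvPowerSeries (Fin 3) k) ^ 2 + (X 1) ^ 3 + (X 2) ^ 5})) := by
  have : Fact (Nat.Prime 5) := ⟨by norm_num⟩
  have hh' := hh
  simp only [Ideal.mem_span_insert, Ideal.mem_span_singleton'] at hh'
  obtain ⟨A, _, ⟨B, _, ⟨Γ, _, ⟨Δ, rfl⟩, rfl⟩, rfl⟩, hABΓΔ⟩ := hh'
  have hsubst : HasSubst ![X 0 ^ 5, X 1 ^ 5, τ] :=
    hasSubst_of_fin_three (by simp) (by simp) (by simp [hτ, hABΓΔ])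
  set h5 := map (frobenius k 5) h
  set w : MvPowerSeries (Fin 2) k := 2 * (X 1 ^ 2 + X 0 ^ 3) + h5 with hw
  have hw0 : constantCoeff w = 0 := by
    simp [hw, h5, hABΓΔ]
  have hτw : τ ^ 5 = expand 5 (by norm_num) w := by
    rw [← map_frobenius_expand 5 (by norm_num), map_expand]
    congr 1
    rw [hτ, hw, map_add, map_mul, map_ofNat]
    simp [h5]
  have h2 : (2 : k) ≠ 0 := by
    have := (CharP.cast_eq_zero_iff k 5 2).not.mpr (by norm_num)
    rwa [Nat.cast_ofNat] at this
  have hderiv : pderiv k 1 τ ≠ 0 := by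
    intro h0
    apply mul_ne_zero h2 h2
    have hcoeff := congrArg (coeff (Finsupp.single 1 1)) h0
    rw [coeff_pderiv, map_zero] at hcoeff
    have hτ2 : coeff (Finsupp.single 1 1 + Finsupp.single 1 1) τ = 2 := by
      have h0 (f : MvPowerSeries (Fin 2) k) (n : ℕ) (hn : n ≠ 0) :
          coeff (Finsupp.single 1 2) (f * X 0 ^ n) = 0 := by
        rw [X_pow_eq, coeff_mul_monomial, if_neg]
        intro h
        simpa [hn] using h 0
      have h1 (f : MvPowerSeries (Fin 2) k) :
          coeff (Finsupp.single 1 2) (f * X 1 ^ 3) = 0 := by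
        rw [X_pow_eq, coeff_mul_monomial, if_neg]
        intro h
        simpa using h 1
      have h2 : coeff (Finsupp.single 1 2) (C 2 * X 1 ^ 2 : MvPowerSeries (Fin 2) k) = 2 := by
        simp [coeff_X_pow]
      rw [← Finsupp.single_add, show τ = C 2 * X 1 ^ 2 + C 2 * X 0 ^ 3 + A * X 0 ^ 4 +
        (B * X 1) * X 0 ^ 2 + (Γ * X 1 ^ 2) * X 0 ^ 1 + Δ * X 1 ^ 3 by
          rw [hτ, hABΓΔ, map_ofNat]; ring]
      simp only [map_add, h1, h2, h0 _ 3 (by norm_num), h0 _ 4 (by norm_num),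
        h0 _ 2 (by norm_num), h0 _ 1 (by norm_num), add_zero]
    rw [← hcoeff, hτ2]
    simp [one_add_one_eq_two]
  have hmem : rename Fin.castSucc h5 ∈ Ideal.span {(X 0 : MvPowerSeries (Fin 3) k) ^ 4,
      (X 0) ^ 2 * X 1, X 0 * (X 1) ^ 2, (X 1) ^ 3} := by
    have := Ideal.mem_map_of_mem ((rename Fin.castSucc : MvPowerSeries (Fin 2) k →ₐ[k]
      MvPowerSeries (Fin 3) k).toRingHom.comp (map (frobenius k 5))) hh
    simpa [Ideal.map_span, Set.image_insert_eq] using this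
  obtain ⟨φ, hφ, hφE⟩ := exists_bijective_algHom_map_eq hmem
  refine ⟨substAlgHom hsubst, substAlgHom_X hsubst 0, substAlgHom_X hsubst 1,
    substAlgHom_X hsubst 2, ⟨?_⟩⟩
  have hker := ker_subst_eq_span (by norm_num) hsubst hw0 hτw hderiv
  have hmap : RingHom.ker (substAlgHom (R := k) hsubst).rangeRestrict =
      (Ideal.span {(X 0 : MvPowerSeries (Fin 3) k) ^ 2 + (X 1) ^ 3 + (X 2) ^ 5}).map
        (RingEquiv.ofBijective φ hφ : _ →+* _) := by
    rw [AlgHom.ker_rangeRestrict, hker, Ideal.map_span, Set.image_singleton]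
    change _ = Ideal.span {φ _}
    rw [hφE, Ideal.span_singleton_mul_left_unit]
    · rw [hw, map_add, map_mul, map_ofNat]
      simp
    · simpa only [map_ofNat] using h2.isUnit.map (C (σ := Fin 3) (R := k))
  exact ((Ideal.quotientEquiv _ _ (RingEquiv.ofBijective φ hφ) hmap).trans
    (Ideal.quotientKerAlgEquivOfSurjective
      (substAlgHom (R := k) hsubst).rangeRestrict_surjective).toRingEquiv).symm
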